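/- Let n be even and L a 2-linear polynomial over F_{q^n} that induces a bijection of F_{q^n}, whose inverse map is written as L^{-1}(x) = Σ_{i=0}^{m-1} L_i(x^{2^i}) where each L_i is a q-linear polynomial over F_{q^n}. Then the following are equivalent: (1) Tr(x^{q+1}) + L(x) is a permutation polynomial of F_{q^n}; (2) L_i(1) ∈ F_{q^2} for all 0 ≤ i < m; (3) F_q ⊆ L(F_{q^2}). -/

import Mathlib

open Polynomial in
/-- Monomial functions with distinct exponents below the cardinality of a finite field are
linearly independent. -/
theorem FiniteField.eq_zero_of_sum_mul_pow_eq_zero {F ι : Type*} [Field F] [Fintype F] [Fintype ι]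
    {k : ι → ℕ} (hk : Function.Injective k) (hlt : ∀ i, k i < Fintype.card F) {d : ι → F}
    (h : ∀ x, ∑ i, d i * x ^ k i = 0) (i : ι) : d i = 0 := by
  classical
  have hP : (∑ j, C (d j) * X ^ k j : F[X]) = 0 := by
    refine eq_zero_of_natDegree_lt_card_of_eval_eq_zero _ Function.injective_id
      (fun x => by simpa [eval_finsetSum] using h x) ?_
    refine (Nat.lt_of_le_pred Fintype.card_pos ?_)
    exact natDegree_sum_le_of_forall_le _ _ fun j _ =>
      (natDegree_C_mul_X_pow_le _ _).trans (Nat.le_pred_of_lt (hlt j))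
  have := congrArg (fun p => coeff p (k i)) hP
  simpa [finsetSum_coeff, coeff_C_mul, coeff_X_pow, hk.eq_iff] using this

theorem Nat.two_pow_add_mul_fin_injective (m n : ℕ) :
    Function.Injective fun p : Fin m × Fin n => 2 ^ ((p.1 : ℕ) + m * (p.2 : ℕ)) := by
  rintro ⟨i, j⟩ ⟨i', j'⟩ h
  have h := Nat.pow_right_injective le_rfl h
  dsimp only at h
  have h1 := congrArg (· % m) h
  have h2 := congrArg (· / m) h
  have hm : 0 < m := i.pos
  simp only [Nat.add_mul_mod_self_left, Nat.mod_eq_of_lt i.2, Nat.mod_eq_of_lt i'.2,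
    Nat.add_mul_div_left _ _ hm, Nat.div_eq_of_lt i.2, Nat.div_eq_of_lt i'.2, zero_add] at h1 h2
  exact Prod.ext (Fin.ext h1) (Fin.ext h2)

theorem Nat.add_mul_fin_lt {m n : ℕ} (i : Fin m) (j : Fin n) : (i : ℕ) + m * (j : ℕ) < m * n :=
  calc (i : ℕ) + m * (j : ℕ) < m * ((j : ℕ) + 1) := by rw [mul_add_one]; have := i.2; omega
    _ ≤ m * n := Nat.mul_le_mul_left _ j.2

/-- The trace sum `∑ i < n, x ^ q ^ i`. -/
def powTrace {F : Type*} [Field F] (q n : ℕ) (x : F) : F := ∑ i ∈ Finset.range n, x ^ q ^ i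

section powTrace

variable {F : Type*} [Field F] {m n : ℕ}

theorem powTrace_add [CharP F 2] (x y : F) :
    powTrace (2 ^ m) n (x + y) = powTrace (2 ^ m) n x + powTrace (2 ^ m) n y := by
  simp only [powTrace, ← pow_mul, add_pow_char_pow, Finset.sum_add_distrib]

theorem powTrace_zero {q : ℕ} (hq : q ≠ 0) : powTrace q n (0 : F) = 0 :=
  Finset.sum_eq_zero fun _ _ => zero_pow (pow_ne_zero _ hq)

theorem pow_pow_eq_self {q : ℕ} {t : F} (ht : t ^ q = t) (i : ℕ) : t ^ q ^ i = t := by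
  induction i with
  | zero => simp
  | succ i ih => rw [pow_succ, pow_mul, ih, ht]

theorem powTrace_mul {q : ℕ} {t : F} (ht : t ^ q = t) (x : F) :
    powTrace q n (t * x) = t * powTrace q n x := by
  simp only [powTrace, mul_pow, pow_pow_eq_self ht, Finset.mul_sum]

theorem powTrace_of_pow_eq_self {q : ℕ} {t : F} (ht : t ^ q = t) :
    powTrace q n t = n * t := by
  simp [powTrace, pow_pow_eq_self ht]

theorem powTrace_pow_arg [Fintype F] {q : ℕ} (hF : Fintype.card F = q ^ n) (x : F) :
    powTrace q n (x ^ q) = powTrace q n x := by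
  have h1 := Finset.sum_range_succ (fun i => x ^ q ^ i) n
  rw [Finset.sum_range_succ', ← hF, FiniteField.pow_card, pow_zero, pow_one] at h1
  simpa only [powTrace, ← pow_mul, ← pow_succ'] using add_right_cancel h1

theorem powTrace_pow [CharP F 2] [Fintype F] (hF : Fintype.card F = (2 ^ m) ^ n) (x : F) :
    powTrace (2 ^ m) n x ^ 2 ^ m = powTrace (2 ^ m) n x := by
  conv_rhs => rw [← powTrace_pow_arg hF]
  simp only [powTrace, sum_pow_char_pow, ← pow_mul, mul_comm]

/-- A `2`-polynomial of degree less than `2 ^ m` vanishing on the trace image is zero. -/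
theorem eq_zero_of_sum_mul_powTrace_pow_eq_zero [CharP F 2] [Fintype F]
    (hF : Fintype.card F = 2 ^ (m * n)) (hn : 0 < n) {e : Fin m → F}
    (h : ∀ x, ∑ i : Fin m, e i * powTrace (2 ^ m) n x ^ 2 ^ (i : ℕ) = 0) (i : Fin m) :
    e i = 0 := by
  refine FiniteField.eq_zero_of_sum_mul_pow_eq_zero (d := fun p : Fin m × Fin n => e p.1)
    (Nat.two_pow_add_mul_fin_injective m n) (fun p => ?_) (fun x => ?_) (i, ⟨0, hn⟩)
  · rw [hF]
    exact Nat.pow_lt_pow_right one_lt_two (Nat.add_mul_fin_lt _ _)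
  · rw [← h x, Fintype.sum_prod_type]
    refine Finset.sum_congr rfl fun i _ => ?_
    rw [powTrace, sum_pow_char_pow, Finset.mul_sum, ← Fin.sum_univ_eq_sum_range
      (fun j => e i * (x ^ (2 ^ m) ^ j) ^ 2 ^ (i : ℕ))]
    simp only [← pow_mul, ← pow_add, add_comm]

theorem exists_powTrace_ne_zero [CharP F 2] [Fintype F] (hF : Fintype.card F = 2 ^ (m * n))
    (hm : 0 < m) (hn : 0 < n) : ∃ u : F, powTrace (2 ^ m) n u ≠ 0 := by
  by_contra! h
  exact one_ne_zero (eq_zero_of_sum_mul_powTrace_pow_eq_zero (e := fun _ => (1 : F)) hF hn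
    (fun x => by simp [h]) ⟨0, hm⟩)

theorem exists_powTrace_eq [CharP F 2] [Fintype F] (hF : Fintype.card F = 2 ^ (m * n))
    (hm : 0 < m) (hn : 0 < n) {t : F} (ht : t ^ 2 ^ m = t) : ∃ z, powTrace (2 ^ m) n z = t := by
  obtain ⟨u, hu⟩ := exists_powTrace_ne_zero hF hm hn
  refine ⟨t / powTrace (2 ^ m) n u * u, ?_⟩
  rw [powTrace_mul, div_mul_cancel₀ _ hu]
  rw [div_pow, ht, powTrace_pow (by rw [hF, pow_mul])]

/-- Polarisation of `x ↦ Tr (x ^ (q + 1))`. -/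
theorem powTrace_add_pow_succ [CharP F 2] [Fintype F] (hF : Fintype.card F = (2 ^ m) ^ n)
    (x a : F) :
    powTrace (2 ^ m) n ((x + a) ^ (2 ^ m + 1)) = powTrace (2 ^ m) n (x ^ (2 ^ m + 1)) +
      (powTrace (2 ^ m) n (x ^ 2 ^ m * (a + a ^ (2 ^ m) ^ 2)) +
        powTrace (2 ^ m) n (a ^ (2 ^ m + 1))) := by
  have h : x ^ 2 ^ m * (a + a ^ (2 ^ m) ^ 2) = x ^ 2 ^ m * a + (x * a ^ 2 ^ m) ^ 2 ^ m := by ring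
  rw [h, powTrace_add _ ((x * a ^ 2 ^ m) ^ 2 ^ m), powTrace_pow_arg hF, ← powTrace_add,
    ← powTrace_add, ← powTrace_add, pow_succ (x + a), add_pow_char_pow]
  congr 1
  ring

/-- For additive bijective `L`, the map `x ↦ Tr (x ^ (q + 1)) + L x` is a permutation iff
`L` maps only elements of `F_{q^2}` into `F_q`. -/
theorem bijective_powTrace_add_iff [CharP F 2] [Fintype F] (hF : Fintype.card F = 2 ^ (m * n))
    (hm : 0 < m) (hn : Even n) (hn0 : 0 < n) {L : F → F} (hL : Function.Bijective L)
    (hadd : ∀ x y, L (x + y) = L x + L y) :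
    (Function.Bijective fun x : F => powTrace (2 ^ m) n (x ^ (2 ^ m + 1)) + L x) ↔
      {x : F | x ^ 2 ^ m = x} ⊆ L '' {x : F | x ^ (2 ^ m) ^ 2 = x} := by
  have hF' : Fintype.card F = (2 ^ m) ^ n := by rw [hF, pow_mul]
  have hdiff (x a : F) : powTrace (2 ^ m) n ((x + a) ^ (2 ^ m + 1)) + L (x + a) =
      powTrace (2 ^ m) n (x ^ (2 ^ m + 1)) + L x ↔
      L a = powTrace (2 ^ m) n (x ^ 2 ^ m * (a + a ^ (2 ^ m) ^ 2)) +
        powTrace (2 ^ m) n (a ^ (2 ^ m + 1)) := by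
    rw [powTrace_add_pow_succ hF', hadd, ← CharTwo.add_eq_zero, ← CharTwo.add_eq_zero (a := L a)]
    refine iff_of_eq (congrArg (· = 0) ?_)
    linear_combination (powTrace (2 ^ m) n (x ^ (2 ^ m + 1)) + L x) * CharTwo.two_eq_zero (R := F)
  rw [← Finite.injective_iff_bijective]
  constructor
  · intro hinj y hy
    obtain ⟨a, rfl⟩ := hL.2 y
    refine ⟨a, ?_, rfl⟩
    by_contra ha
    have hb : a + a ^ (2 ^ m) ^ 2 ≠ 0 := fun h => ha (CharTwo.add_eq_zero.1 h).symm
    obtain ⟨z, hz⟩ := exists_powTrace_eq hF hm hn0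
      (t := L a + powTrace (2 ^ m) n (a ^ (2 ^ m + 1))) (by
        rw [add_pow_char_pow, powTrace_pow hF', Set.mem_ofPred.1 hy])
    obtain ⟨x, hx⟩ := (Finite.injective_iff_surjective.1
      (iterateFrobenius F 2 m).injective) (z / (a + a ^ (2 ^ m) ^ 2))
    rw [iterateFrobenius_def] at hx
    have := hinj ((hdiff x a).2 (by
      rw [hx, div_mul_cancel₀ _ hb, hz, add_assoc, CharTwo.add_self_eq_zero, add_zero]))
    rw [add_eq_left] at this
    exact ha (by simp [this])
  · intro hsub x y hxy
    obtain ⟨a, rfl⟩ : ∃ a, x + a = y := ⟨y - x, by ring⟩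
    have hLa := (hdiff x a).1 hxy.symm
    obtain ⟨b, hb, hab⟩ := hsub (show L a ^ 2 ^ m = L a by
      rw [hLa, ← powTrace_add, powTrace_pow hF'])
    obtain rfl := hL.1 hab
    rw [Set.mem_ofPred] at hb
    have hnorm : (b ^ (2 ^ m + 1)) ^ 2 ^ m = b ^ (2 ^ m + 1) := by
      calc _ = b ^ (2 ^ m) ^ 2 * b ^ 2 ^ m := by ring
        _ = _ := by rw [hb]; ring
    rw [hb, CharTwo.add_self_eq_zero, mul_zero, powTrace_zero (by positivity),
      powTrace_of_pow_eq_self hnorm, (CharP.cast_eq_zero_iff F 2 n).2 hn.two_dvd, zero_mul,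
      add_zero] at hLa
    have hL0 : L 0 = 0 := by simpa using hadd 0 0
    rw [hL.1 (hLa.trans hL0.symm), add_zero]

end powTrace


/-- Let `n` be even, `q = 2^m`, `F` the field with `q^n` elements, and `L` a
`2`-linear polynomial over `F` inducing a bijection of `F`, with inverse map written as
`L⁻¹(x) = Σ_{i<m} L_i(x^(2^i))` where `L_i(x) = Σ_{j<n} c i j · x^(q^j)` is `q`-linear.  Then
the following are equivalent: (1) `Tr(x^(q+1)) + L(x)` is a permutation polynomial of `F`;
(2) `L_i(1) ∈ F_{q^2}` for all `i`; (3) `F_q ⊆ L(F_{q^2})`. -/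
theorem stmt_19 (m n : ℕ) (hm : 0 < m) (hn : Even n) (hn0 : 0 < n)
    (F : Type*) [Field F] [Fintype F] (hF : Fintype.card F = 2 ^ (m * n))
    (a : Fin (m * n) → F) (c : Fin m → Fin n → F)
    (L Linv Tr : F → F)
    (hL : ∀ x, L x = ∑ i : Fin (m * n), a i * x ^ 2 ^ (i : ℕ))
    (hLinv : ∀ x, Linv x = ∑ i : Fin m, ∑ j : Fin n,
        c i j * x ^ 2 ^ ((i : ℕ) + m * (j : ℕ)))
    (hinv1 : ∀ x, Linv (L x) = x) (hinv2 : ∀ x, L (Linv x) = x)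
    (hTr : ∀ x, Tr x = ∑ i ∈ Finset.range n, x ^ (2 ^ m) ^ i) :
    ((Function.Bijective (fun x : F => Tr (x ^ (2 ^ m + 1)) + L x) ↔
        ∀ i : Fin m, (∑ j : Fin n, c i j) ^ (2 ^ m) ^ 2 = ∑ j : Fin n, c i j) ∧
      ((∀ i : Fin m, (∑ j : Fin n, c i j) ^ (2 ^ m) ^ 2 = ∑ j : Fin n, c i j) ↔
        {x : F | x ^ 2 ^ m = x} ⊆ L '' {x : F | x ^ (2 ^ m) ^ 2 = x})) := by
  have : CharP F 2 := charP_of_card_eq_prime_pow hF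
  have hF' : Fintype.card F = (2 ^ m) ^ n := by rw [hF, pow_mul]
  obtain rfl : Tr = powTrace (2 ^ m) n := funext hTr
  have hadd (x y : F) : L (x + y) = L x + L y := by
    simp only [hL, add_pow_char_pow, mul_add, Finset.sum_add_distrib]
  have hbij : Function.Bijective L :=
    ⟨Function.LeftInverse.injective hinv1, Function.RightInverse.surjective hinv2⟩
  have hLinv' {t : F} (ht : t ^ 2 ^ m = t) :
      Linv t = ∑ i : Fin m, (∑ j : Fin n, c i j) * t ^ 2 ^ (i : ℕ) := by
    simp only [hLinv, Finset.sum_mul]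
    refine Finset.sum_congr rfl fun i _ => Finset.sum_congr rfl fun j _ => ?_
    rw [add_comm, pow_add, pow_mul 2, pow_mul, pow_pow_eq_self ht]
  have hsq {t : F} (ht : t ^ 2 ^ m = t) : Linv t ^ (2 ^ m) ^ 2 =
      ∑ i : Fin m, (∑ j : Fin n, c i j) ^ (2 ^ m) ^ 2 * t ^ 2 ^ (i : ℕ) := by
    rw [hLinv' ht, ← pow_mul, sum_pow_char_pow]
    simp only [mul_pow, pow_mul]
    refine Finset.sum_congr rfl fun i _ => ?_
    rw [← pow_mul _ (2 ^ (i : ℕ)), mul_comm (2 ^ (i : ℕ)), pow_mul, pow_pow_eq_self ht]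
  have h23 : (∀ i : Fin m, (∑ j : Fin n, c i j) ^ (2 ^ m) ^ 2 = ∑ j : Fin n, c i j) ↔
      {x : F | x ^ 2 ^ m = x} ⊆ L '' {x : F | x ^ (2 ^ m) ^ 2 = x} := by
    constructor
    · intro h t ht
      refine ⟨Linv t, ?_, hinv2 t⟩
      rw [Set.mem_ofPred, hsq ht, hLinv' ht]
      simp only [h]
    · intro h i
      refine sub_eq_zero.1 (eq_zero_of_sum_mul_powTrace_pow_eq_zero (e := fun i =>
        (∑ j : Fin n, c i j) ^ (2 ^ m) ^ 2 - ∑ j : Fin n, c i j) hF hn0 (fun x => ?_) i)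
      have ht := powTrace_pow hF' x
      obtain ⟨b, hb, hbt⟩ := h ht
      simp only [sub_mul, Finset.sum_sub_distrib]
      rw [← hsq ht, ← hLinv' ht, ← hbt, hinv1, hb, sub_self]
  exact ⟨(bijective_powTrace_add_iff hF hm hn hn0 hbij hadd).trans h23.symm, h23⟩
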